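/- arXiv:1801.01394 — 5 statements merged into one kernel-verified Lean document; each statement's English description precedes it below -/
import Mathlib

section
/- If λ ≥ 2‖Xᵀε‖∞ and the compatibility condition holds with constant ν > 0, then any LASSO solution β̃(λ) satisfies ‖Xβ̃(λ) − Xβ*‖₂²/n ≤ 16 s λ² / (ν² n²). -/
open Matrix BigOperators Finset

/-- The ℓ1-norm of a vector. -/
noncomputable def norm1 {m : ℕ} (v : Fin m → ℝ) : ℝ := ∑ i, |v i|

/-- The squared ℓ2-norm of a vector. -/
noncomputable def norm2sq {m : ℕ} (v : Fin m → ℝ) : ℝ := ∑ i, (v i) ^ 2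

/-- The ℓ2-norm of a vector. -/
noncomputable def norm2 {m : ℕ} (v : Fin m → ℝ) : ℝ := Real.sqrt (∑ i, (v i) ^ 2)

/-- The ℓ∞ (sup) norm of a vector (the Pi norm on `Fin m → ℝ`). -/
noncomputable def normInf {m : ℕ} (v : Fin m → ℝ) : ℝ := ‖v‖

/-- `b` is a LASSO solution with tuning parameter `lam`:
a minimizer over `β ∈ ℝ^p` of `‖Y − Xβ‖₂² + 2 lam ‖β‖₁`. -/
def IsLassoSol {n p : ℕ} (X : Matrix (Fin n) (Fin p) ℝ) (Y : Fin n → ℝ) (lam : ℝ)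
    (b : Fin p → ℝ) : Prop :=
  ∀ β : Fin p → ℝ,
    norm2sq (Y - X.mulVec b) + 2 * lam * norm1 b ≤
      norm2sq (Y - X.mulVec β) + 2 * lam * norm1 β

/-- The support of a vector, as a `Finset`. -/
noncomputable def supp {m : ℕ} (b : Fin m → ℝ) : Finset (Fin m) :=
  @Finset.filter _ (fun i => b i ≠ 0) (Classical.decPred _) Finset.univ

/-- The compatibility condition with constant `ν` for the set `S`:
`ν √n ‖η_S‖₁ ≤ √(|S|) ‖Xη‖₂` for all `η` with `‖η_{Sᶜ}‖₁ ≤ 3 ‖η_S‖₁`. -/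
def Compat {n p : ℕ} (X : Matrix (Fin n) (Fin p) ℝ) (S : Finset (Fin p)) (ν : ℝ) : Prop :=
  ∀ η : Fin p → ℝ, (∑ i ∈ Sᶜ, |η i|) ≤ 3 * ∑ i ∈ S, |η i| →
    ν * Real.sqrt n * (∑ i ∈ S, |η i|) ≤ Real.sqrt (S.card) * norm2 (X.mulVec η)

/-- Hölder's inequality between the ℓ∞- and ℓ1-norms. -/
lemma dotProduct_le_normInf_mul_norm1 {m : ℕ} (u v : Fin m → ℝ) :
    u ⬝ᵥ v ≤ normInf u * norm1 v := by
  unfold normInf norm1 dotProduct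
  rw [Finset.mul_sum]
  refine Finset.sum_le_sum fun i _ => (le_abs_self _).trans ?_
  rw [abs_mul]
  exact mul_le_mul_of_nonneg_right (norm_le_pi_norm u i) (abs_nonneg _)

lemma norm1_eq_sum_add_sum_compl {m : ℕ} (S : Finset (Fin m)) (v : Fin m → ℝ) :
    norm1 v = ∑ i ∈ S, |v i| + ∑ i ∈ Sᶜ, |v i| :=
  (Finset.sum_add_sum_compl S _).symm

lemma norm2sq_sub {m : ℕ} (u v : Fin m → ℝ) :
    norm2sq (u - v) = norm2sq u - 2 * (u ⬝ᵥ v) + norm2sq v := by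
  simp only [norm2sq, dotProduct, Pi.sub_apply, Finset.mul_sum, ← Finset.sum_sub_distrib,
    ← Finset.sum_add_distrib]
  exact Finset.sum_congr rfl fun i _ => by ring

/-- Off its support a vector contributes nothing, so the ℓ1-norm decreases by at most the
on-support part of the perturbation minus the off-support part. -/
lemma norm1_sub_norm1_le {m : ℕ} (u v : Fin m → ℝ) :
    norm1 u - norm1 v ≤ ∑ i ∈ supp u, |(v - u) i| - ∑ i ∈ (supp u)ᶜ, |(v - u) i| := by
  have h_on : ∑ i ∈ supp u, |u i| ≤ ∑ i ∈ supp u, |v i| + ∑ i ∈ supp u, |(v - u) i| := by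
    rw [← Finset.sum_add_distrib]
    refine Finset.sum_le_sum fun i _ => ?_
    have := abs_sub_abs_le_abs_sub (u i) (v i)
    rw [abs_sub_comm] at this
    rw [Pi.sub_apply]
    linarith
  have hu (i) (hi : i ∈ (supp u)ᶜ) : u i = 0 := by simpa [supp] using hi
  have h_off : ∑ i ∈ (supp u)ᶜ, |u i| = 0 :=
    Finset.sum_eq_zero fun i hi => by rw [hu i hi, abs_zero]
  have h_diff : ∑ i ∈ (supp u)ᶜ, |(v - u) i| = ∑ i ∈ (supp u)ᶜ, |v i| :=
    Finset.sum_congr rfl fun i hi => by rw [Pi.sub_apply, hu i hi, sub_zero]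
  rw [norm1_eq_sum_add_sum_compl (supp u) u, norm1_eq_sum_add_sum_compl (supp u) v]
  linarith

/-- The basic inequality for the LASSO. -/
lemma IsLassoSol.norm2sq_le {n p : ℕ} {X : Matrix (Fin n) (Fin p) ℝ} {βs b : Fin p → ℝ}
    {ε : Fin n → ℝ} {lam : ℝ} (hb : IsLassoSol X (X.mulVec βs + ε) lam b) (hlam0 : 0 ≤ lam)
    (hlam : 2 * normInf (Xᵀ.mulVec ε) ≤ lam) :
    norm2sq (X.mulVec (b - βs)) ≤
      lam * (3 * ∑ i ∈ supp βs, |(b - βs) i| - ∑ i ∈ (supp βs)ᶜ, |(b - βs) i|) := by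
  have hmin := hb βs
  have hres : X.mulVec βs + ε - X.mulVec b = ε - X.mulVec (b - βs) := by
    rw [Matrix.mulVec_sub]; abel
  rw [hres, add_sub_cancel_left, norm2sq_sub] at hmin
  have hdual : ε ⬝ᵥ X.mulVec (b - βs) = Xᵀ.mulVec ε ⬝ᵥ (b - βs) := by
    rw [Matrix.dotProduct_mulVec, Matrix.mulVec_transpose]
  have hnoise := dotProduct_le_normInf_mul_norm1 (Xᵀ.mulVec ε) (b - βs)
  have hnonneg : 0 ≤ norm1 (b - βs) := Finset.sum_nonneg fun _ _ => abs_nonneg _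
  have hscale := mul_le_mul_of_nonneg_right hlam hnonneg
  have hpen := mul_le_mul_of_nonneg_left (norm1_sub_norm1_le βs b) hlam0
  rw [norm1_eq_sum_add_sum_compl (supp βs) (b - βs)] at hnoise hscale
  rw [hdual] at hmin
  linarith

/-- Lemma 1 (fast-rate bound for the LASSO): if `λ ≥ 2‖Xᵀε‖∞` and the compatibility
condition holds with constant `ν > 0`, then any LASSO solution `β̃(λ)` satisfies
`‖Xβ̃(λ) − Xβ*‖₂²/n ≤ 16 s λ² / (ν² n²)`. -/
theorem lasso_fast_rate {n p : ℕ} (X : Matrix (Fin n) (Fin p) ℝ)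
    (βs : Fin p → ℝ) (ε Y : Fin n → ℝ) (hY : Y = X.mulVec βs + ε)
    (lam ν : ℝ) (hlam0 : 0 < lam) (hν : 0 < ν)
    (hlam : lam ≥ 2 * normInf (Xᵀ.mulVec ε))
    (hcompat : Compat X (supp βs) ν)
    (b : Fin p → ℝ) (hb : IsLassoSol X Y lam b) :
    norm2sq (X.mulVec b - X.mulVec βs) / n ≤
      16 * (supp βs).card * lam ^ 2 / (ν ^ 2 * n ^ 2) := by
  subst hY
  rw [← Matrix.mulVec_sub]
  have hbasic := hb.norm2sq_le hlam0.le hlam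
  have hD : 0 ≤ norm2sq (X.mulVec (b - βs)) := Finset.sum_nonneg fun _ _ => sq_nonneg _
  have hA : 0 ≤ ∑ i ∈ supp βs, |(b - βs) i| := Finset.sum_nonneg fun _ _ => abs_nonneg _
  have hB : 0 ≤ ∑ i ∈ (supp βs)ᶜ, |(b - βs) i| := Finset.sum_nonneg fun _ _ => abs_nonneg _
  have hcone : ∑ i ∈ (supp βs)ᶜ, |(b - βs) i| ≤ 3 * ∑ i ∈ supp βs, |(b - βs) i| :=
    sub_nonneg.1 (nonneg_of_mul_nonneg_right (hD.trans hbasic) hlam0)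
  have hsq := pow_le_pow_left₀ (by positivity) (hcompat _ hcone) 2
  have hnorm : norm2 (X.mulVec (b - βs)) ^ 2 = norm2sq (X.mulVec (b - βs)) := Real.sq_sqrt hD
  rw [mul_pow, mul_pow, mul_pow, Real.sq_sqrt n.cast_nonneg, Real.sq_sqrt (Nat.cast_nonneg _),
    hnorm] at hsq
  generalize norm2sq (X.mulVec (b - βs)) = D at *
  generalize ∑ i ∈ supp βs, |(b - βs) i| = A at *
  have hDA : D ≤ 3 * lam * A := by nlinarith
  rcases n.eq_zero_or_pos with rfl | hn
  · simp
  have hn : (0 : ℝ) < n := Nat.cast_pos.2 hn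
  have hs : (0 : ℝ) ≤ (supp βs).card := Nat.cast_nonneg _
  generalize ((supp βs).card : ℝ) = s at *
  have hmain : D * (ν ^ 2 * n) ≤ 9 * s * lam ^ 2 := by
    rcases hD.eq_or_lt with rfl | hDpos
    · rw [zero_mul]; positivity
    refine le_of_mul_le_mul_right ?_ hDpos
    calc D * (ν ^ 2 * n) * D = D ^ 2 * (ν ^ 2 * n) := by ring
      _ ≤ (3 * lam * A) ^ 2 * (ν ^ 2 * n) := by gcongr
      _ = 9 * lam ^ 2 * (ν ^ 2 * n * A ^ 2) := by ring
      _ ≤ 9 * lam ^ 2 * (s * D) := by gcongr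
      _ = 9 * s * lam ^ 2 * D := by ring
  rw [div_le_div_iff₀ hn (by positivity)]
  have hslack : 0 ≤ s * lam ^ 2 := by positivity
  calc D * (ν ^ 2 * n ^ 2) = D * (ν ^ 2 * n) * n := by ring
    _ ≤ 16 * s * lam ^ 2 * n := mul_le_mul_of_nonneg_right (by linarith) hn.le
end

section
/- Suppose ‖XᵀXβ*‖∞ ≥ (1 + 2/c)‖Xᵀε‖∞ (Assumption 2). If û ≤ ‖XᵀY‖∞, then any TREX solution β̂ satisfies ‖Xβ̂ − Xβ*‖₂²/n ≤ (2‖Xᵀε‖∞ + max{û, 2‖Xᵀε‖∞/c})‖β*‖₁/n. -/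
open Matrix BigOperators Finset

/-- The TREX objective with constant `c`. -/
noncomputable def trexObj {n p : ℕ} (X : Matrix (Fin n) (Fin p) ℝ) (Y : Fin n → ℝ)
    (c : ℝ) (β : Fin p → ℝ) : ℝ :=
  norm2sq (Y - X.mulVec β) / (c * normInf (Xᵀ.mulVec (Y - X.mulVec β))) + norm1 β

/-- `b` is a TREX solution: a minimizer of the TREX objective over all `β` with
`Xᵀ(Y − Xβ) ≠ 0` (in particular `û := ‖Xᵀ(Y − Xb)‖∞` is nonzero). -/
def IsTrexSol {n p : ℕ} (X : Matrix (Fin n) (Fin p) ℝ) (Y : Fin n → ℝ) (c : ℝ)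
    (b : Fin p → ℝ) : Prop :=
  Xᵀ.mulVec (Y - X.mulVec b) ≠ 0 ∧
    ∀ β : Fin p → ℝ, Xᵀ.mulVec (Y - X.mulVec β) ≠ 0 →
      trexObj X Y c b ≤ trexObj X Y c β

theorem norm2sq_eq_dotProduct {m : ℕ} (v : Fin m → ℝ) : norm2sq v = v ⬝ᵥ v := by
  simp [norm2sq, dotProduct, sq]

theorem norm2sq_nonneg {m : ℕ} (v : Fin m → ℝ) : 0 ≤ norm2sq v :=
  Finset.sum_nonneg fun i _ => sq_nonneg (v i)

theorem norm1_nonneg {m : ℕ} (v : Fin m → ℝ) : 0 ≤ norm1 v :=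
  Finset.sum_nonneg fun i _ => abs_nonneg (v i)

/-- Hölder's inequality for the dual pair of the sup-norm and the ℓ1-norm. -/
theorem abs_dotProduct_le_normInf_mul_norm1 {m : ℕ} (v w : Fin m → ℝ) :
    |v ⬝ᵥ w| ≤ normInf v * norm1 w := by
  rw [dotProduct, norm1, Finset.mul_sum]
  refine (Finset.abs_sum_le_sum_abs _ _).trans (Finset.sum_le_sum fun i _ => ?_)
  rw [abs_mul]
  exact mul_le_mul_of_nonneg_right (norm_le_pi_norm v i) (abs_nonneg _)

theorem abs_dotProduct_mulVec_le {n p : ℕ} (X : Matrix (Fin n) (Fin p) ℝ)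
    (v : Fin n → ℝ) (β : Fin p → ℝ) :
    |v ⬝ᵥ X.mulVec β| ≤ normInf (Xᵀ.mulVec v) * norm1 β := by
  rw [dotProduct_mulVec, ← mulVec_transpose]
  exact abs_dotProduct_le_normInf_mul_norm1 _ _

/-- Theorem 2 (slow-rate bound for the TREX): under Assumption 2
(`‖XᵀXβ*‖∞ ≥ (1 + 2/c)‖Xᵀε‖∞`) and `û ≤ ‖XᵀY‖∞`, any TREX solution `β̂` satisfies
`‖Xβ̂ − Xβ*‖₂²/n ≤ (2‖Xᵀε‖∞ + max{û, 2‖Xᵀε‖∞/c})‖β*‖₁/n`. -/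
theorem trex_slow_rate {n p : ℕ} (X : Matrix (Fin n) (Fin p) ℝ)
    (βs : Fin p → ℝ) (ε Y : Fin n → ℝ) (hY : Y = X.mulVec βs + ε)
    (c : ℝ) (hc : 0 < c) (hc2 : c < 2)
    (hA2 : normInf (Xᵀ.mulVec (X.mulVec βs)) ≥ (1 + 2 / c) * normInf (Xᵀ.mulVec ε))
    (bT : Fin p → ℝ) (hbT : IsTrexSol X Y c bT)
    (u : ℝ) (hu : u = normInf (Xᵀ.mulVec (Y - X.mulVec bT)))
    (huY : u ≤ normInf (Xᵀ.mulVec Y)) :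
    norm2sq (X.mulVec bT - X.mulVec βs) / n ≤
      (2 * normInf (Xᵀ.mulVec ε) + max u (2 * normInf (Xᵀ.mulVec ε) / c)) *
        norm1 βs / n := by
  subst hY
  set E := normInf (Xᵀ.mulVec ε)
  set Y := X.mulVec βs + ε with hY
  set g := normInf (Xᵀ.mulVec Y) with hg
  set v := max u (2 * E / c)
  have hu0 : 0 < u := hu ▸ norm_pos_iff.2 hbT.1
  have hg0 : 0 < g := hu0.trans_le huY
  have huv : u ≤ v := le_max_left _ _
  have hv0 : 0 < v := hu0.trans_le huv
  have hEv : 2 * E ≤ c * v := by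
    have : 2 * E / c ≤ v := le_max_right _ _
    rwa [div_le_iff₀ hc, mul_comm v] at this
  have hvg : v ≤ g := by
    refine max_le huY ?_
    have htri : normInf (Xᵀ.mulVec (X.mulVec βs)) ≤ g + E := by
      have h : Xᵀ.mulVec (X.mulVec βs) = Xᵀ.mulVec Y - Xᵀ.mulVec ε := by
        rw [← mulVec_sub, hY, add_sub_cancel_right]
      rw [h]
      exact norm_sub_le _ _
    have h : (1 + 2 / c) * E = E + 2 * E / c := by ring
    linarith
  have hopt : norm2sq (Y - X.mulVec bT) + c * v * norm1 bT ≤ v / g * norm2sq Y := by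
    have h := hbT.2 0 (by simpa using norm_pos_iff.1 hg0)
    simp only [trexObj, mulVec_zero, sub_zero, ← hu, ← hg] at h
    have hzero : norm1 (0 : Fin p → ℝ) = 0 := by simp [norm1]
    rw [hzero, add_zero] at h
    have h' := mul_le_mul_of_nonneg_left h (mul_pos hc hv0).le
    have hleft : c * v * (norm2sq (Y - X.mulVec bT) / (c * u) + norm1 bT) =
        v / u * norm2sq (Y - X.mulVec bT) + c * v * norm1 bT := by field_simp
    have hright : c * v * (norm2sq Y / (c * g)) = v / g * norm2sq Y := by field_simp
    rw [hleft, hright] at h'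
    have := le_mul_of_one_le_left (norm2sq_nonneg (Y - X.mulVec bT)) ((one_le_div hu0).2 huv)
    linarith
  have hYsq : norm2sq Y = Y ⬝ᵥ X.mulVec βs + ε ⬝ᵥ X.mulVec βs + norm2sq ε := by
    simp only [norm2sq_eq_dotProduct, hY, dotProduct_add, add_dotProduct,
      dotProduct_comm (X.mulVec βs) ε]
    ring
  have hloss : norm2sq (X.mulVec bT - X.mulVec βs) = norm2sq (Y - X.mulVec bT) - norm2sq ε +
      2 * (ε ⬝ᵥ X.mulVec bT) - 2 * (ε ⬝ᵥ X.mulVec βs) := by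
    simp only [norm2sq_eq_dotProduct, hY, dotProduct_add, add_dotProduct, dotProduct_sub,
      sub_dotProduct, dotProduct_comm _ ε, dotProduct_comm (X.mulVec βs) (X.mulVec bT)]
    ring
  have hYβ := (abs_le.1 (abs_dotProduct_mulVec_le X Y βs)).2
  have hεβ := (abs_le.1 (abs_dotProduct_mulVec_le X ε βs)).1
  have hεb := (abs_le.1 (abs_dotProduct_mulVec_le X ε bT)).2
  have hEb := mul_le_mul_of_nonneg_right hEv (norm1_nonneg bT)
  have hEβ : 0 ≤ E * norm1 βs := mul_nonneg (norm_nonneg _) (norm1_nonneg _)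
  have hr0 : 0 ≤ v / g := (div_pos hv0 hg0).le
  have hr1 : v / g ≤ 1 := (div_le_one hg0).2 hvg
  have hscale : v / g * (Y ⬝ᵥ X.mulVec βs) ≤ v * norm1 βs := by
    refine (mul_le_mul_of_nonneg_left hYβ hr0).trans_eq ?_
    rw [← mul_assoc, div_mul_cancel₀ _ hg0.ne']
  have hcross : (v / g - 2) * (ε ⬝ᵥ X.mulVec βs) ≤ 2 * (E * norm1 βs) := by
    have h := mul_le_mul_of_nonneg_left hεβ (show 0 ≤ 2 - v / g by linarith)
    have := mul_nonneg hr0 hEβ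
    linarith
  have hnoise : v / g * norm2sq ε ≤ norm2sq ε :=
    mul_le_of_le_one_left (norm2sq_nonneg ε) hr1
  rw [hYsq] at hopt
  refine div_le_div_of_nonneg_right ?_ (Nat.cast_nonneg n)
  linarith
end

section
/- Let Ω be a norm on ℝ^p with dual norm Ω*. Suppose Ω*(XᵀXβ*) ≥ (1 + 2/c)Ω*(Xᵀε) (Assumption 3), and set û := Ω*(Xᵀ(Y − Xβ̂)). If û ≤ Ω*(XᵀY), then any generalized TREX solution β̂ satisfies ‖Xβ̂ − Xβ*‖₂²/n ≤ (2Ω*(Xᵀε) + max{û, (2/c)Ω*(Xᵀε)})Ω(β*)/n. -/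
open Matrix BigOperators Finset

/-- The dual norm `Ω*(η) := sup { ηᵀβ : Ω(β) ≤ 1 }`. -/
noncomputable def dualNorm {m : ℕ} (Om : (Fin m → ℝ) → ℝ) (η : Fin m → ℝ) : ℝ :=
  sSup ((fun β => ∑ i, η i * β i) '' {β | Om β ≤ 1})

/-- The generalized TREX objective with norm `Om` and constant `c`. -/
noncomputable def gtrexObj {n p : ℕ} (X : Matrix (Fin n) (Fin p) ℝ) (Y : Fin n → ℝ)
    (Om : (Fin p → ℝ) → ℝ) (c : ℝ) (β : Fin p → ℝ) : ℝ :=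
  norm2sq (Y - X.mulVec β) / (c * dualNorm Om (Xᵀ.mulVec (Y - X.mulVec β))) + Om β

/-- `b` is a generalized TREX solution: a minimizer of the generalized TREX objective
over all `β` with `Xᵀ(Y − Xβ) ≠ 0`. -/
def IsGTrexSol {n p : ℕ} (X : Matrix (Fin n) (Fin p) ℝ) (Y : Fin n → ℝ)
    (Om : (Fin p → ℝ) → ℝ) (c : ℝ) (b : Fin p → ℝ) : Prop :=
  Xᵀ.mulVec (Y - X.mulVec b) ≠ 0 ∧
    ∀ β : Fin p → ℝ, Xᵀ.mulVec (Y - X.mulVec β) ≠ 0 →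
      gtrexObj X Y Om c b ≤ gtrexObj X Y Om c β

theorem exists_forall_le_mul_of_finiteDimensional {V : Type*} [AddCommGroup V] [Module ℝ V]
    [FiniteDimensional ℝ V] {N : V → ℝ}
    (hadd : ∀ x y, N (x + y) ≤ N x + N y) (hsmul : ∀ (a : ℝ) (x : V), N (a • x) = |a| * N x)
    (hdef : ∀ x, N x = 0 → x = 0) (L : V →ₗ[ℝ] ℝ) : ∃ C, ∀ x, L x ≤ C * N x := by
  have hN0 : N 0 = 0 := by simpa using hsmul 0 0
  let G : AddGroupNorm V :=
    { toFun := N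
      map_zero' := hN0
      add_le' := hadd
      neg' := fun x => by simpa using hsmul (-1) x
      eq_zero_of_map_eq_zero' := hdef }
  let _ : NormedAddCommGroup V := G.toNormedAddCommGroup
  let _ : NormedSpace ℝ V := ⟨fun a x => (hsmul a x).le⟩
  exact ⟨‖LinearMap.toContinuousLinearMap L‖, fun x =>
    (le_abs_self _).trans ((LinearMap.toContinuousLinearMap L).le_opNorm x)⟩

section DualNorm

variable {m : ℕ} {Om : (Fin m → ℝ) → ℝ}

theorem norm_nonneg_of_add_le_of_smul
    (hadd : ∀ x y : Fin m → ℝ, Om (x + y) ≤ Om x + Om y)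
    (hsmul : ∀ (a : ℝ) (x : Fin m → ℝ), Om (a • x) = |a| * Om x) (x : Fin m → ℝ) :
    0 ≤ Om x := by
  have h0 : Om 0 = 0 := by simpa using hsmul 0 0
  have h1 : Om (-x) = Om x := by simpa using hsmul (-1) x
  have h2 := hadd x (-x)
  rw [add_neg_cancel, h0, h1] at h2
  linarith

theorem bddAbove_image_dotProduct
    (hadd : ∀ x y : Fin m → ℝ, Om (x + y) ≤ Om x + Om y)
    (hsmul : ∀ (a : ℝ) (x : Fin m → ℝ), Om (a • x) = |a| * Om x)
    (hdef : ∀ x : Fin m → ℝ, Om x = 0 → x = 0) (η : Fin m → ℝ) :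
    BddAbove ((fun β => ∑ i, η i * β i) '' {β | Om β ≤ 1}) := by
  have hpos := norm_nonneg_of_add_le_of_smul hadd hsmul
  obtain ⟨C, hC⟩ := exists_forall_le_mul_of_finiteDimensional hadd hsmul hdef
    (dotProductBilin ℝ ℝ η)
  refine ⟨|C|, ?_⟩
  rintro _ ⟨x, hx, rfl⟩
  refine (hC x).trans ?_
  have hx' : Om x ≤ 1 := hx
  nlinarith [hpos x, le_abs_self C, abs_nonneg C]

theorem dualNorm_nonneg
    (hadd : ∀ x y : Fin m → ℝ, Om (x + y) ≤ Om x + Om y)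
    (hsmul : ∀ (a : ℝ) (x : Fin m → ℝ), Om (a • x) = |a| * Om x)
    (hdef : ∀ x : Fin m → ℝ, Om x = 0 → x = 0) (η : Fin m → ℝ) : 0 ≤ dualNorm Om η := by
  have hOm0 : Om 0 = 0 := by simpa using hsmul 0 0
  exact le_csSup (bddAbove_image_dotProduct hadd hsmul hdef η) ⟨0, by simp [hOm0], by simp⟩

theorem dotProduct_le_dualNorm_mul
    (hadd : ∀ x y : Fin m → ℝ, Om (x + y) ≤ Om x + Om y)
    (hsmul : ∀ (a : ℝ) (x : Fin m → ℝ), Om (a • x) = |a| * Om x)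
    (hdef : ∀ x : Fin m → ℝ, Om x = 0 → x = 0) (η β : Fin m → ℝ) :
    η ⬝ᵥ β ≤ dualNorm Om η * Om β := by
  rcases (norm_nonneg_of_add_le_of_smul hadd hsmul β).eq_or_lt with h | h
  · rw [← h, hdef β h.symm]; simp
  have hmem : η ⬝ᵥ ((Om β)⁻¹ • β) ≤ dualNorm Om η := by
    refine le_csSup (bddAbove_image_dotProduct hadd hsmul hdef η) ⟨(Om β)⁻¹ • β, ?_, rfl⟩
    simp [hsmul, abs_of_pos h, h.ne']
  rw [dotProduct_smul, smul_eq_mul, inv_mul_le_iff₀ h] at hmem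
  linarith

theorem abs_dotProduct_le_dualNorm_mul
    (hadd : ∀ x y : Fin m → ℝ, Om (x + y) ≤ Om x + Om y)
    (hsmul : ∀ (a : ℝ) (x : Fin m → ℝ), Om (a • x) = |a| * Om x)
    (hdef : ∀ x : Fin m → ℝ, Om x = 0 → x = 0) (η β : Fin m → ℝ) :
    |η ⬝ᵥ β| ≤ dualNorm Om η * Om β := by
  have h1 : Om (-β) = Om β := by simpa using hsmul (-1) β
  have h2 := dotProduct_le_dualNorm_mul hadd hsmul hdef η (-β)
  rw [dotProduct_neg, h1] at h2
  exact abs_le.2 ⟨by linarith, dotProduct_le_dualNorm_mul hadd hsmul hdef η β⟩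

theorem dualNorm_zero (hOm0 : Om 0 = 0) : dualNorm Om 0 = 0 := by
  have : ((fun β : Fin m → ℝ => ∑ i, (0 : Fin m → ℝ) i * β i) '' {β | Om β ≤ 1}) = {0} := by
    ext y
    simp only [Pi.zero_apply, zero_mul, Finset.sum_const_zero, Set.mem_image, Set.mem_ofPred_eq,
      Set.mem_singleton_iff]
    exact ⟨fun ⟨_, _, h⟩ => h.symm, fun h => ⟨0, by simp [hOm0], h.symm⟩⟩
  rw [dualNorm, this, csSup_singleton]

theorem dualNorm_smul_add_smul_le
    (hadd : ∀ x y : Fin m → ℝ, Om (x + y) ≤ Om x + Om y)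
    (hsmul : ∀ (a : ℝ) (x : Fin m → ℝ), Om (a • x) = |a| * Om x)
    (hdef : ∀ x : Fin m → ℝ, Om x = 0 → x = 0) (a b : ℝ) (η ξ : Fin m → ℝ) :
    dualNorm Om (a • η + b • ξ) ≤ |a| * dualNorm Om η + |b| * dualNorm Om ξ := by
  have hOm0 : Om 0 = 0 := by simpa using hsmul 0 0
  have hle : ∀ (s : ℝ) (ζ β : Fin m → ℝ), Om β ≤ 1 → s * (ζ ⬝ᵥ β) ≤ |s| * dualNorm Om ζ := by
    intro s ζ β hβ
    have h1 := abs_dotProduct_le_dualNorm_mul hadd hsmul hdef ζ β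
    have h2 := mul_le_of_le_one_right (dualNorm_nonneg hadd hsmul hdef ζ) hβ
    calc s * (ζ ⬝ᵥ β) ≤ |s| * |ζ ⬝ᵥ β| := (le_abs_self _).trans (abs_mul _ _).le
      _ ≤ |s| * dualNorm Om ζ := mul_le_mul_of_nonneg_left (h1.trans h2) (abs_nonneg s)
  refine csSup_le ⟨_, 0, by simp [hOm0], rfl⟩ ?_
  rintro _ ⟨β, hβ, rfl⟩
  change (a • η + b • ξ) ⬝ᵥ β ≤ _
  rw [add_dotProduct, smul_dotProduct, smul_dotProduct, smul_eq_mul, smul_eq_mul]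
  exact add_le_add (hle a η β hβ) (hle b ξ β hβ)

theorem continuous_dualNorm_add_smul
    (hadd : ∀ x y : Fin m → ℝ, Om (x + y) ≤ Om x + Om y)
    (hsmul : ∀ (a : ℝ) (x : Fin m → ℝ), Om (a • x) = |a| * Om x)
    (hdef : ∀ x : Fin m → ℝ, Om x = 0 → x = 0) (η ξ : Fin m → ℝ) :
    Continuous fun s : ℝ => dualNorm Om (η + s • ξ) := by
  have hconv : ConvexOn ℝ Set.univ fun s : ℝ => dualNorm Om (η + s • ξ) := by
    refine ⟨convex_univ, fun s _ t _ a b ha hb hab => ?_⟩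
    have h := dualNorm_smul_add_smul_le hadd hsmul hdef a b (η + s • ξ) (η + t • ξ)
    rw [abs_of_nonneg ha, abs_of_nonneg hb] at h
    have heq : a • (η + s • ξ) + b • (η + t • ξ) = η + (a • s + b • t) • ξ := by
      rw [smul_add, smul_add, add_add_add_comm, ← add_smul, hab, one_smul, smul_smul, smul_smul,
        ← add_smul, smul_eq_mul, smul_eq_mul]
    rwa [heq] at h
  simpa [continuousOn_univ] using hconv.continuousOn isOpen_univ

end DualNorm

theorem le_mul_of_trex_inequality {c u M R d B w : ℝ} (hc1 : 1 < c) (hu : 0 < u) (huM : u ≤ M)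
    (hw : 0 < w) (hR : 0 ≤ R) (hB : 0 ≤ B) (hQ : d + B ≤ M * w) (hCS : d ^ 2 ≤ R * B)
    (h : R * (M - u) + c * u * M * w ≤ u * (2 * d + B)) :
    (c - 1) * M * w ≤ d ∧ 4 * (c - 1) * M ≤ c ^ 2 * u := by
  have hM : 0 < M := hu.trans_le huM
  have hRM : 0 ≤ R * (M - u) := mul_nonneg hR (sub_nonneg.2 huM)
  have h1 : (c - 1) * M * w ≤ d := by
    refine le_of_mul_le_mul_left ?_ hu
    nlinarith
  have hd : 0 < d := lt_of_lt_of_le (by have := sub_pos.2 hc1; positivity) h1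
  refine ⟨h1, ?_⟩
  set a := M * w with ha
  have ha0 : 0 < a := by positivity
  have h2 : d ^ 2 ≤ R * (a - d) :=
    hCS.trans (mul_le_mul_of_nonneg_left (by linarith) hR)
  have h3 : R * (M - u) ≤ u * (d - (c - 1) * a) := by nlinarith
  have had : 0 ≤ a - d := by linarith
  have h4 : (M - u) * d ^ 2 ≤ u * (d - (c - 1) * a) * (a - d) :=
    calc (M - u) * d ^ 2 ≤ (M - u) * (R * (a - d)) :=
          mul_le_mul_of_nonneg_left h2 (sub_nonneg.2 huM)
      _ = R * (M - u) * (a - d) := by ring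
      _ ≤ _ := mul_le_mul_of_nonneg_right h3 had
  have h5 : (2 * M * d - u * c * a) ^ 2 ≤ u * a ^ 2 * (c ^ 2 * u - 4 * (c - 1) * M) := by
    nlinarith [mul_le_mul_of_nonneg_left h4 hM.le]
  have h6 : 0 ≤ u * a ^ 2 * (c ^ 2 * u - 4 * (c - 1) * M) := (sq_nonneg _).trans h5
  have h7 := nonneg_of_mul_nonneg_right h6 (by positivity)
  linarith

theorem path_coefficient_le {c e v M t : ℝ} (hc1 : 1 < c) (hc2 : c < 2) (he : 0 ≤ e)
    (hv : 0 < v) (hve : 2 * e ≤ c * v) (ht0 : 0 ≤ t) (ht1 : t ≤ 1)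
    (htM : v ≤ (1 - t) * M + t * e) (hM : 4 * (c - 1) * M ≤ c ^ 2 * v) :
    (1 + t) * e + (1 + (c - 1) * t) * v ≤ 2 * e + v + (c * v - 2 * e) := by
  have hev : e < v := by nlinarith
  suffices h : 0 ≤ (1 - t) * (c * v - e) + t * (v - 2 * e) by linarith
  rcases le_or_gt (2 * e) v with h2 | h2
  · exact add_nonneg (mul_nonneg (by linarith) (by linarith)) (mul_nonneg ht0 (by linarith))
  have hMe : 0 < M - e := by
    by_contra hcon
    nlinarith [mul_nonneg (sub_nonneg.2 ht1) (by linarith : 0 ≤ e - M)]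
  have h3 : 4 * (c - 1) * (M - v) ≤ (2 - c) ^ 2 * v := by linarith
  have h4 : (2 * e - v) * ((2 - c) ^ 2 * v) ≤ (c - 1) * v * ((2 - c) ^ 2 * v) :=
    mul_le_mul_of_nonneg_right (by linarith) (by positivity)
  have h5 : v * (2 - c) / 2 * (c * v / 2) ≤ (v - e) * (c * v - e) :=
    mul_le_mul (by linarith) (by linarith) (by positivity) (by linarith)
  have h6 : 0 ≤ (c - 1) * (2 - c) * v ^ 2 * (c - 1) := by
    have := sub_pos.2 hc1
    have := sub_pos.2 hc2
    positivity
  have h7 : (2 * e - v) * (M - v) ≤ (v - e) * (c * v - e) := by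
    have hc4 : 0 < 4 * (c - 1) := by linarith
    refine le_of_mul_le_mul_left ?_ hc4
    nlinarith [mul_le_mul_of_nonneg_left h3 (sub_nonneg.2 h2.le),
      mul_le_mul_of_nonneg_left h5 hc4.le]
  have h8 : (v - e) * (c * v - v + e) ≤ (1 - t) * (M - e) * (c * v - v + e) :=
    mul_le_mul_of_nonneg_right (by linarith) (by nlinarith)
  refine nonneg_of_mul_nonneg_right (?_ : 0 ≤ (M - e) * _) hMe
  nlinarith

theorem mul_add_le_of_div_add_le {c u v R A w s : ℝ} (hc : 0 < c) (hu : 0 < u) (hv : 0 < v)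
    (h : R / (c * u) + w ≤ A / (c * v) + s) :
    v * R + c * u * v * w ≤ u * (A + c * v * s) := by
  have h1 := mul_le_mul_of_nonneg_left h (by positivity : 0 ≤ c * u * v)
  have e1 : c * u * v * (R / (c * u) + w) = v * R + c * u * v * w := by field_simp
  have e2 : c * u * v * (A / (c * v) + s) = u * (A + c * v * s) := by field_simp
  rwa [e1, e2] at h1

theorem transpose_mulVec_dotProduct {n p : ℕ} (X : Matrix (Fin n) (Fin p) ℝ) (r : Fin n → ℝ)
    (β : Fin p → ℝ) : (Xᵀ *ᵥ r) ⬝ᵥ β = r ⬝ᵥ (X *ᵥ β) := by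
  rw [dotProduct_mulVec, mulVec_transpose]

theorem dotProduct_sq_le {m : ℕ} (v w : Fin m → ℝ) :
    (v ⬝ᵥ w) ^ 2 ≤ (v ⬝ᵥ v) * (w ⬝ᵥ w) := by
  simpa [dotProduct, pow_two] using Finset.sum_mul_sq_le_sq_mul_sq Finset.univ v w

/-- Theorem 3 / Theorem 6 (slow-rate bound for the generalized TREX): for a norm `Ω` on
`ℝ^p`, under Assumption 3 (`Ω*(XᵀXβ*) ≥ (1 + 2/c)Ω*(Xᵀε)`) and `û ≤ Ω*(XᵀY)`, any
generalized TREX solution `β̂` satisfies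
`‖Xβ̂ − Xβ*‖₂²/n ≤ (2Ω*(Xᵀε) + max{û, (2/c)Ω*(Xᵀε)})Ω(β*)/n`. -/
theorem gtrex_slow_rate {n p : ℕ} (X : Matrix (Fin n) (Fin p) ℝ)
    (βs : Fin p → ℝ) (ε Y : Fin n → ℝ) (hY : Y = X.mulVec βs + ε)
    (Om : (Fin p → ℝ) → ℝ)
    (hOm_add : ∀ x y : Fin p → ℝ, Om (x + y) ≤ Om x + Om y)
    (hOm_smul : ∀ (a : ℝ) (x : Fin p → ℝ), Om (a • x) = |a| * Om x)
    (hOm_def : ∀ x : Fin p → ℝ, Om x = 0 → x = 0)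
    (c : ℝ) (hc : 0 < c) (hc2 : c < 2)
    (hA3 : dualNorm Om (Xᵀ.mulVec (X.mulVec βs)) ≥
      (1 + 2 / c) * dualNorm Om (Xᵀ.mulVec ε))
    (bT : Fin p → ℝ) (hbT : IsGTrexSol X Y Om c bT)
    (u : ℝ) (hu : u = dualNorm Om (Xᵀ.mulVec (Y - X.mulVec bT))) (hu0 : u ≠ 0)
    (huY : u ≤ dualNorm Om (Xᵀ.mulVec Y)) :
    norm2sq (X.mulVec bT - X.mulVec βs) / n ≤
      (2 * dualNorm Om (Xᵀ.mulVec ε) + max u (2 / c * dualNorm Om (Xᵀ.mulVec ε))) *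
        Om βs / n := by
  subst hY
  have hab := abs_dotProduct_le_dualNorm_mul hOm_add hOm_smul hOm_def
  have hnn := dualNorm_nonneg hOm_add hOm_smul hOm_def
  have hcomb := dualNorm_smul_add_smul_le hOm_add hOm_smul hOm_def
  have hpos := norm_nonneg_of_add_le_of_smul hOm_add hOm_smul
  have hOm0 : Om 0 = 0 := by simpa using hOm_smul 0 0
  have hu_pos : 0 < u := lt_of_le_of_ne (hu ▸ hnn _) hu0.symm
  have hne : ∀ r : Fin n → ℝ, 0 < dualNorm Om (Xᵀ.mulVec r) → Xᵀ.mulVec r ≠ 0 := by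
    intro r hr h0
    rw [h0, dualNorm_zero hOm0] at hr
    exact hr.false
  set e := dualNorm Om (Xᵀ.mulVec ε) with he
  set M := dualNorm Om (Xᵀ.mulVec (X.mulVec βs + ε)) with hM
  set v := max u (2 / c * e) with hv
  have he0 : 0 ≤ e := hnn _
  have huv : u ≤ v := le_max_left _ _
  have hv_pos : 0 < v := hu_pos.trans_le huv
  have hve : 2 * e ≤ c * v := by
    have h := mul_le_mul_of_nonneg_left (le_max_right u (2 / c * e)) hc.le
    rwa [← mul_assoc, mul_div_cancel₀ _ hc.ne'] at h
  have hvM : v ≤ M := by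
    refine max_le huY ?_
    have h := hcomb 1 (-1) (Xᵀ.mulVec (X.mulVec βs + ε)) (Xᵀ.mulVec ε)
    rw [← mulVec_smul, ← mulVec_smul, ← mulVec_add, one_smul, neg_one_smul,
      add_neg_cancel_right] at h
    simp only [abs_neg, abs_one, one_mul] at h
    linarith
  -- a point on the ray through `βs` whose residual has dual norm exactly `v`
  obtain ⟨t, ht0, ht1, htv⟩ : ∃ t : ℝ, 0 ≤ t ∧ t ≤ 1 ∧
      dualNorm Om (Xᵀ.mulVec (X.mulVec βs + ε - X.mulVec (t • βs))) = v := by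
    have hres : ∀ t : ℝ, Xᵀ.mulVec (X.mulVec βs + ε - X.mulVec (t • βs)) =
        Xᵀ.mulVec (X.mulVec βs + ε) + t • -(Xᵀ.mulVec (X.mulVec βs)) := by
      intro t
      rw [mulVec_sub, mulVec_smul, mulVec_smul, smul_neg, sub_eq_add_neg]
    have hcont : Continuous fun t : ℝ =>
        dualNorm Om (Xᵀ.mulVec (X.mulVec βs + ε - X.mulVec (t • βs))) := by
      simp only [hres]
      exact continuous_dualNorm_add_smul hOm_add hOm_smul hOm_def _ _
    have hev : e ≤ v := by nlinarith
    obtain ⟨t, ⟨ht0, ht1⟩, ht⟩ := intermediate_value_Icc' zero_le_one hcont.continuousOn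
      (show v ∈ _ by simpa using ⟨hev, hvM⟩)
    exact ⟨t, ht0, ht1, ht⟩
  have htM : v ≤ (1 - t) * M + t * e := by
    have h := hcomb (1 - t) t (Xᵀ.mulVec (X.mulVec βs + ε)) (Xᵀ.mulVec ε)
    have heq : (1 - t) • (X.mulVec βs + ε) + t • ε =
        X.mulVec βs + ε - X.mulVec (t • βs) := by
      rw [mulVec_smul]
      module
    rwa [← mulVec_smul, ← mulVec_smul, ← mulVec_add, heq, htv, abs_of_nonneg (sub_nonneg.2 ht1),
      abs_of_nonneg ht0] at h
  have hf0 := hbT.2 0 (hne _ (by simpa using hu_pos.trans_le huY))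
  have hft := hbT.2 (t • βs) (hne _ (by rw [htv]; exact hv_pos))
  have hεβ := hab (Xᵀ.mulVec ε) βs
  have hεb := hab (Xᵀ.mulVec ε) bT
  have hrβ := hab (Xᵀ.mulVec (X.mulVec βs + ε - X.mulVec bT)) βs
  have hrb := hab (Xᵀ.mulVec (X.mulVec βs + ε - X.mulVec bT)) bT
  have hYb := hab (Xᵀ.mulVec (X.mulVec βs + ε)) bT
  have htβ := hab (Xᵀ.mulVec (X.mulVec βs + ε - X.mulVec (t • βs))) βs
  have hCS := dotProduct_sq_le (X.mulVec βs + ε - X.mulVec bT) (X.mulVec bT)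
  have hR : 0 ≤ norm2sq (X.mulVec βs + ε - X.mulVec bT) := Finset.sum_nonneg fun i _ => sq_nonneg _
  have hB : 0 ≤ norm2sq (X.mulVec bT) := Finset.sum_nonneg fun i _ => sq_nonneg _
  have hD : 0 ≤ norm2sq (X.mulVec bT - X.mulVec βs) := Finset.sum_nonneg fun i _ => sq_nonneg _
  have hw := hpos bT
  have hs := hpos βs
  unfold gtrexObj at hf0 hft
  rw [htv, ← hu, hOm_smul, abs_of_nonneg ht0] at hft
  rw [mulVec_zero, sub_zero, ← hM, ← hu, hOm0, add_zero] at hf0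
  rw [← hu] at hrβ hrb
  rw [htv] at htβ
  rw [← he] at hεβ hεb
  rw [← hM] at hYb
  rw [← add_zero (norm2sq (X.mulVec βs + ε) / (c * M))] at hf0
  have hf0' := mul_add_le_of_div_add_le hc hu_pos (hv_pos.trans_le hvM) hf0
  have hft' : norm2sq (X.mulVec βs + ε - X.mulVec bT) + c * v * Om bT ≤
      norm2sq (X.mulVec βs + ε - X.mulVec (t • βs)) + c * v * (t * Om βs) := by
    refine le_of_mul_le_mul_left ?_ hu_pos
    nlinarith [mul_add_le_of_div_add_le hc hu_pos hv_pos hft,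
      mul_le_mul_of_nonneg_right huv hR]
  clear hf0 hft htv hne hab hnn hcomb hpos hbT hu
  refine div_le_div_of_nonneg_right ?_ (Nat.cast_nonneg n)
  simp only [mulVec_smul, transpose_mulVec_dotProduct, norm2sq_eq_dotProduct] at *
  generalize X.mulVec βs = P at *
  generalize X.mulVec bT = q at *
  simp only [sub_dotProduct, dotProduct_sub, add_dotProduct, dotProduct_add, smul_dotProduct,
    dotProduct_smul, smul_eq_mul, dotProduct_comm q P, dotProduct_comm q ε,
    dotProduct_comm P ε] at *
  rw [abs_le] at hεβ hεb hrβ hrb hYb htβ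
  have hB1 : q ⬝ᵥ q - P ⬝ᵥ q - (P ⬝ᵥ q - P ⬝ᵥ P) ≤
      (e + v) * Om βs + e * Om bT - (P ⬝ᵥ q + ε ⬝ᵥ q - q ⬝ᵥ q) := by
    linarith [mul_le_mul_of_nonneg_right huv hs]
  have hB2 : q ⬝ᵥ q - P ⬝ᵥ q - (P ⬝ᵥ q - P ⬝ᵥ P) ≤
      ((1 + t) * e + (1 + (c - 1) * t) * v) * Om βs - (c * v - 2 * e) * Om bT := by
    have h1 := mul_le_mul_of_nonneg_left htβ.2 (sub_nonneg.2 ht1)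
    have h2 := mul_le_mul_of_nonneg_left hεβ.1 (by linarith : 0 ≤ 1 + t)
    linarith
  have hvew : 0 ≤ (c * v - 2 * e) * Om bT := mul_nonneg (sub_nonneg.2 hve) hw
  rcases le_or_gt c 1 with hc1 | hc1
  · have h : (1 + t) * e + (1 + (c - 1) * t) * v ≤ 2 * e + v := by
      have h1 := mul_nonneg (mul_nonneg (sub_nonneg.2 hc1) ht0) hv_pos.le
      have h2 := mul_nonneg (sub_nonneg.2 ht1) he0
      linarith
    linarith [mul_le_mul_of_nonneg_right h hs]
  have hbounds : 0 < Om bT → (c - 1) * M * Om bT ≤ P ⬝ᵥ q + ε ⬝ᵥ q - q ⬝ᵥ q ∧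
      4 * (c - 1) * M ≤ c ^ 2 * u := fun hw' =>
    le_mul_of_trex_inequality hc1 hu_pos huY hw' hR hB (by linarith) hCS (by linarith)
  rcases le_or_gt (Om bT) (Om βs) with hws | hws
  · have hd : 0 ≤ P ⬝ᵥ q + ε ⬝ᵥ q - q ⬝ᵥ q := by
      rcases hw.eq_or_lt with h | h
      · have h1 := hrb.1
        rwa [← h, mul_zero, neg_zero] at h1
      · have hM0 := hu_pos.trans_le huY
        exact le_trans (mul_nonneg (mul_nonneg (sub_nonneg.2 hc1.le) hM0.le) hw) (hbounds h).1
    linarith [mul_le_mul_of_nonneg_left hws he0]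
  · have hMv : 4 * (c - 1) * M ≤ c ^ 2 * v :=
      (hbounds (hs.trans_lt hws)).2.trans (mul_le_mul_of_nonneg_left huv (sq_nonneg c))
    have h := mul_le_mul_of_nonneg_right
      (path_coefficient_le hc1 hc2 he0 hv_pos hve ht0 ht1 htM hMv) hs
    linarith [mul_le_mul_of_nonneg_left hws.le (sub_nonneg.2 hve)]
end

section
/- If β̃ is a LASSO solution with tuning parameter λ > 0 and β̃ ≠ 0, then ‖Xᵀ(Y − Xβ̃)‖∞ = λ (the KKT stationarity condition for the LASSO at a nonzero minimizer). -/
open Matrix BigOperators Finset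

theorem nonpos_of_forall_le_mul {a d : ℝ} (h : ∀ s : ℝ, 0 < s → s ≤ 1 → a ≤ s * d) :
    a ≤ 0 := by
  have ht : Filter.Tendsto (fun s : ℝ => s * d) (nhdsWithin 0 (Set.Ioi 0)) (nhds 0) := by
    have hc : Continuous fun s : ℝ => s * d := by fun_prop
    simpa using (hc.tendsto 0).mono_left nhdsWithin_le_nhds
  refine ge_of_tendsto ht ?_
  filter_upwards [Ioc_mem_nhdsGT (zero_lt_one' ℝ)] with s hs using h s hs.1 hs.2

theorem norm1_add_single {m : ℕ} (b : Fin m → ℝ) (j : Fin m) (t : ℝ) :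
    norm1 (b + Pi.single j t) = norm1 b + (|b j + t| - |b j|) := by
  have h : ∀ i, |(b + Pi.single j t : Fin m → ℝ) i| - |b i| =
      if i = j then |b j + t| - |b j| else 0 := by
    intro i
    by_cases hij : i = j
    · subst hij; simp
    · simp [hij]
  have hs : norm1 (b + Pi.single j t) - norm1 b = |b j + t| - |b j| := by
    simp only [norm1, ← Finset.sum_sub_distrib, h]
    simp
  linarith

theorem norm2sq_residual_add_single {n p : ℕ} (X : Matrix (Fin n) (Fin p) ℝ) (Y : Fin n → ℝ)
    (b : Fin p → ℝ) (j : Fin p) (t : ℝ) :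
    norm2sq (Y - X.mulVec (b + Pi.single j t)) =
      norm2sq (Y - X.mulVec b) - 2 * t * (Xᵀ.mulVec (Y - X.mulVec b)) j
        + t ^ 2 * norm2sq (X.col j) := by
  have hg : (Xᵀ.mulVec (Y - X.mulVec b)) j = ∑ i, X i j * (Y - X.mulVec b) i := rfl
  rw [hg]
  simp only [norm2sq, Finset.mul_sum, ← Finset.sum_sub_distrib, ← Finset.sum_add_distrib]
  refine Finset.sum_congr rfl fun i _ => ?_
  simp only [Matrix.mulVec_add, Matrix.mulVec_single, Pi.sub_apply, Pi.add_apply, Pi.smul_apply,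
    MulOpposite.smul_eq_mul_unop, MulOpposite.unop_op, Matrix.col_apply]
  ring

theorem IsLassoSol.two_mul_gradient_le {n p : ℕ} {X : Matrix (Fin n) (Fin p) ℝ} {Y : Fin n → ℝ}
    {lam : ℝ} {b : Fin p → ℝ} (hb : IsLassoSol X Y lam b) (j : Fin p) (t : ℝ) :
    2 * t * (Xᵀ.mulVec (Y - X.mulVec b)) j ≤
      t ^ 2 * norm2sq (X.col j) + 2 * lam * (|b j + t| - |b j|) := by
  have h := hb (b + Pi.single j t)
  rw [norm2sq_residual_add_single, norm1_add_single] at h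
  linarith

theorem IsLassoSol.abs_gradient_le {n p : ℕ} {X : Matrix (Fin n) (Fin p) ℝ} {Y : Fin n → ℝ}
    {lam : ℝ} {b : Fin p → ℝ} (hlam : 0 ≤ lam) (hb : IsLassoSol X Y lam b) (j : Fin p) :
    |(Xᵀ.mulVec (Y - X.mulVec b)) j| ≤ lam := by
  have key : ∀ ε : ℝ, |ε| = 1 → ε * (Xᵀ.mulVec (Y - X.mulVec b)) j ≤ lam := by
    intro ε hε
    refine sub_nonpos.1 (nonpos_of_forall_le_mul (d := norm2sq (X.col j) / 2) fun s hs _ => ?_)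
    have h := hb.two_mul_gradient_le j (s * ε)
    have habs : |b j + s * ε| - |b j| ≤ s := by
      have := abs_add_le (b j) (s * ε)
      rw [abs_mul, hε, abs_of_pos hs] at this
      linarith
    have hsq : ε ^ 2 = 1 := by rw [← sq_abs, hε, one_pow]
    rw [mul_pow, hsq] at h
    have := mul_le_mul_of_nonneg_left habs hlam
    refine le_of_mul_le_mul_left ?_ hs
    linarith
  have h₁ := key 1 (by simp)
  have h₂ := key (-1) (by simp)
  exact abs_le.2 ⟨by linarith, by linarith⟩

theorem IsLassoSol.le_abs_gradient {n p : ℕ} {X : Matrix (Fin n) (Fin p) ℝ} {Y : Fin n → ℝ}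
    {lam : ℝ} {b : Fin p → ℝ} (hb : IsLassoSol X Y lam b) {j : Fin p} (hj : b j ≠ 0) :
    lam ≤ |(Xᵀ.mulVec (Y - X.mulVec b)) j| := by
  have key : lam * |b j| ≤ b j * (Xᵀ.mulVec (Y - X.mulVec b)) j := by
    refine sub_nonpos.1
      (nonpos_of_forall_le_mul (d := b j ^ 2 * norm2sq (X.col j) / 2) fun s hs hs1 => ?_)
    have h := hb.two_mul_gradient_le j (-s * b j)
    have habs : |b j + -s * b j| = (1 - s) * |b j| := by
      rw [show b j + -s * b j = (1 - s) * b j by ring, abs_mul, abs_of_nonneg (by linarith)]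
    rw [habs] at h
    refine le_of_mul_le_mul_left ?_ hs
    linarith
  have h := key.trans (le_abs_self _)
  rw [abs_mul, mul_comm] at h
  exact le_of_mul_le_mul_left h (abs_pos.2 hj)

/-- KKT stationarity condition for the LASSO at a nonzero minimizer: if `β̃` is a LASSO
solution with tuning parameter `λ > 0` and `β̃ ≠ 0`, then `‖Xᵀ(Y − Xβ̃)‖∞ = λ`. -/
theorem lasso_kkt {n p : ℕ} (X : Matrix (Fin n) (Fin p) ℝ) (Y : Fin n → ℝ)
    (lam : ℝ) (hlam : 0 < lam)
    (b : Fin p → ℝ) (hb : IsLassoSol X Y lam b) (hb0 : b ≠ 0) :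
    normInf (Xᵀ.mulVec (Y - X.mulVec b)) = lam := by
  obtain ⟨j, hj⟩ := Function.ne_iff.1 hb0
  refine le_antisymm ((pi_norm_le_iff_of_nonneg hlam.le).2 fun i => ?_) ?_
  · exact hb.abs_gradient_le hlam.le i
  · exact (hb.le_abs_gradient hj).trans (norm_le_pi_norm (Xᵀ.mulVec (Y - X.mulVec b)) j)
end

section
/- Let κ₁ > 1 and let λ̃ := max{κ₁û, (κ₂/c)‖Xᵀε‖∞} for some κ₂ > 0. If û ≤ ‖XᵀY‖∞/κ₁, then any TREX solution β̂ and any LASSO solution β̃(λ̃) satisfy ‖Y − Xβ̂‖₂² ≤ ‖Y − Xβ̃(λ̃)‖₂²/κ₁. -/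
open Matrix BigOperators Finset

theorem norm2sq_add_smul {m : ℕ} (v w : Fin m → ℝ) (t : ℝ) :
    norm2sq (v + t • w) = norm2sq v + 2 * t * (w ⬝ᵥ v) + t ^ 2 * norm2sq w := by
  simp only [norm2sq, dotProduct, Finset.mul_sum, ← Finset.sum_add_distrib]
  refine Finset.sum_congr rfl fun i _ => ?_
  simp only [Pi.add_apply, Pi.smul_apply, smul_eq_mul]
  ring

theorem norm1_smul {m : ℕ} (v : Fin m → ℝ) (t : ℝ) : norm1 (t • v) = |t| * norm1 v := by
  simp [norm1, Finset.mul_sum, abs_mul]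

theorem norm1_pos {m : ℕ} {v : Fin m → ℝ} (hv : v ≠ 0) : 0 < norm1 v := by
  obtain ⟨i, hi⟩ := Function.ne_iff.mp hv
  exact Finset.sum_pos' (fun _ _ => abs_nonneg _) ⟨i, Finset.mem_univ i, abs_pos.mpr hi⟩

/-- Hölder's inequality for the ℓ1- and sup-norms. -/
theorem dotProduct_le_norm1_mul_normInf {m : ℕ} (v w : Fin m → ℝ) :
    v ⬝ᵥ w ≤ norm1 v * normInf w := by
  simp only [dotProduct, norm1, Finset.sum_mul]
  refine Finset.sum_le_sum fun i _ => ?_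
  calc v i * w i ≤ |v i * w i| := le_abs_self _
    _ = |v i| * |w i| := abs_mul _ _
    _ ≤ |v i| * normInf w :=
      mul_le_mul_of_nonneg_left (norm_le_pi_norm w i) (abs_nonneg _)

theorem nonpos_of_forall_le_mul_s11 {a b : ℝ} (hb : 0 ≤ b)
    (h : ∀ t : ℝ, 0 < t → t ≤ 1 → a ≤ t * b) : a ≤ 0 := by
  by_contra! ha
  have hab : 0 < a + b := by linarith
  have h1 := h (a / (a + b)) (by positivity) ((div_le_one hab).mpr (by linarith))
  rw [div_mul_eq_mul_div, le_div_iff₀ hab] at h1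
  nlinarith

/-- The residual of a nonzero LASSO solution has correlation at least the tuning parameter. -/
theorem IsLassoSol.le_normInf {n p : ℕ} {X : Matrix (Fin n) (Fin p) ℝ} {Y : Fin n → ℝ} {lam : ℝ}
    {b : Fin p → ℝ} (h : IsLassoSol X Y lam b) (hb : b ≠ 0) :
    lam ≤ normInf (Xᵀ.mulVec (Y - X.mulVec b)) := by
  have key : lam * norm1 b - X.mulVec b ⬝ᵥ (Y - X.mulVec b) ≤ 0 := by
    refine nonpos_of_forall_le_mul_s11 (norm2sq_nonneg (X.mulVec b)) fun t ht ht1 => ?_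
    have h1 := h ((1 - t) • b)
    have hres : Y - X.mulVec ((1 - t) • b) = (Y - X.mulVec b) + t • X.mulVec b := by
      rw [Matrix.mulVec_smul, sub_smul, one_smul]
      abel
    rw [hres, norm2sq_add_smul, norm1_smul, abs_of_nonneg (by linarith)] at h1
    have h2 : t * (lam * norm1 b - X.mulVec b ⬝ᵥ (Y - X.mulVec b)) ≤
        t * (t * norm2sq (X.mulVec b)) := by
      nlinarith [mul_nonneg (sq_nonneg t) (norm2sq_nonneg (X.mulVec b))]
    exact le_of_mul_le_mul_left h2 ht
  have hdual : X.mulVec b ⬝ᵥ (Y - X.mulVec b) = b ⬝ᵥ Xᵀ.mulVec (Y - X.mulVec b) := by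
    rw [Matrix.mulVec_transpose, dotProduct_comm, Matrix.dotProduct_mulVec, dotProduct_comm]
  have h3 := dotProduct_le_norm1_mul_normInf b (Xᵀ.mulVec (Y - X.mulVec b))
  refine le_of_mul_le_mul_left ?_ (norm1_pos hb)
  linarith

/-- If `κ₁ > 1`, `λ̃ := max{κ₁û, (κ₂/c)‖Xᵀε‖∞}` for some `κ₂ > 0`, and
`û ≤ ‖XᵀY‖∞/κ₁`, then any TREX solution `β̂` and any LASSO solution `β̃(λ̃)` satisfy
`‖Y − Xβ̂‖₂² ≤ ‖Y − Xβ̃(λ̃)‖₂²/κ₁`. -/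
theorem trex_residual_bound {n p : ℕ} (X : Matrix (Fin n) (Fin p) ℝ)
    (βs : Fin p → ℝ) (ε Y : Fin n → ℝ) (hY : Y = X.mulVec βs + ε)
    (c : ℝ) (hc : 0 < c) (hc2 : c < 2)
    (hε : 0 < normInf (Xᵀ.mulVec ε))
    (κ₁ κ₂ : ℝ) (hκ₁ : 1 < κ₁) (hκ₂ : 0 < κ₂)
    (bT : Fin p → ℝ) (hbT : IsTrexSol X Y c bT)
    (u lamt : ℝ) (hu : u = normInf (Xᵀ.mulVec (Y - X.mulVec bT)))
    (hlamt : lamt = max (κ₁ * u) (κ₂ / c * normInf (Xᵀ.mulVec ε)))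
    (huY : u ≤ normInf (Xᵀ.mulVec Y) / κ₁)
    (bL : Fin p → ℝ) (hbL : IsLassoSol X Y lamt bL) :
    norm2sq (Y - X.mulVec bT) ≤ norm2sq (Y - X.mulVec bL) / κ₁ := by
  have hu0 : 0 < u := hu ▸ norm_pos_iff.mpr hbT.1
  have hκ0 : 0 < κ₁ := by linarith
  have hRT := norm2sq_nonneg (Y - X.mulVec bT)
  have hRL := norm2sq_nonneg (Y - X.mulVec bL)
  rw [le_div_iff₀ hκ0]
  have trex_le : ∀ v, κ₁ * u ≤ v → v ≤ normInf (Xᵀ.mulVec (Y - X.mulVec bL)) →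
      norm2sq (Y - X.mulVec bT) / (c * u) + norm1 bT ≤
        norm2sq (Y - X.mulVec bL) / (c * v) + norm1 bL := by
    intro v hv hvL
    have hv0 : 0 < v := (mul_pos hκ0 hu0).trans_le hv
    have h1 := hbT.2 bL (norm_pos_iff.mp (hv0.trans_le hvL))
    simp only [trexObj, ← hu] at h1
    refine h1.trans ?_
    gcongr
  rcases eq_or_ne bL 0 with h0 | h0
  · have hle : κ₁ * u ≤ normInf (Xᵀ.mulVec (Y - X.mulVec bL)) := by
      rw [le_div_iff₀ hκ0] at huY
      simpa [h0, mul_comm] using huY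
    have h1 := trex_le (κ₁ * u) le_rfl hle
    have h2 : norm1 bL = 0 := by simp [h0, norm1]
    have h3 : norm2sq (Y - X.mulVec bT) / (c * u) ≤
        norm2sq (Y - X.mulVec bL) / (c * (κ₁ * u)) := by
      linarith [norm1_nonneg bT]
    rw [div_le_div_iff₀ (by positivity) (by positivity)] at h3
    refine le_of_mul_le_mul_right ?_ (mul_pos hc hu0)
    linarith
  · have hlam : κ₁ * u ≤ lamt := hlamt ▸ le_max_left _ _
    have hlam0 : 0 < lamt := (mul_pos hκ0 hu0).trans_le hlam
    have h1 := trex_le lamt hlam (hbL.le_normInf h0)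
    have h2 := hbL bT
    have h3 : κ₁ / (c * lamt) ≤ 1 / (c * u) := by
      rw [div_le_div_iff₀ (by positivity) (by positivity)]
      nlinarith
    have h4 : norm2sq (Y - X.mulVec bT) * (κ₁ / (c * lamt)) ≤
        norm2sq (Y - X.mulVec bT) / (c * u) := by
      rw [div_eq_mul_one_div _ (c * u)]
      exact mul_le_mul_of_nonneg_left h3 hRT
    have h5 := mul_le_mul_of_nonneg_left (h4.trans (le_sub_iff_add_le.mpr h1))
      (mul_pos hc hlam0).le
    generalize norm2sq (Y - X.mulVec bT) = A at *
    generalize norm2sq (Y - X.mulVec bL) = B at *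
    have e1 : c * lamt * (A * (κ₁ / (c * lamt))) = A * κ₁ := by field_simp
    have e2 : c * lamt * (B / (c * lamt) + norm1 bL - norm1 bT) =
        B + c * (lamt * norm1 bL - lamt * norm1 bT) := by field_simp; ring
    rw [e1, e2] at h5
    have h6 : c * (2 * lamt * norm1 bL - 2 * lamt * norm1 bT) ≤ c * (A - B) :=
      mul_le_mul_of_nonneg_left (by linarith) hc.le
    have h7 : A * (2 * κ₁ - c) ≤ B * (2 - c) := by linarith
    have h8 : A * κ₁ * (2 - c) ≤ A * (2 * κ₁ - c) := by
      nlinarith [mul_nonneg hRT (mul_nonneg hc.le (sub_nonneg.mpr hκ₁.le))]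
    exact le_of_mul_le_mul_right (h8.trans h7) (sub_pos.mpr hc2)
end
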